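/- Let ⊢{c}Γ be derived by the dependency type system. Then: (1) if pc ∉ Γ(x) for a program variable x and ⟨c,σ⟩ →* ⟨skip,σ'⟩, then σ(x) = σ'(x); (2) if pc ∉ Γ(a) for a channel a and ⟨c,σ⟩ ⇒t_a,*, then t = ε; (3) if pc ∉ Γ(a_p) for a channel–program-point pair a_p and c run from σ produces a trace, then no output of that trace is produced by an output statement at a_p. -/

import Mathlib

/-- Program variables. -/
abbrev PVar := String
/-- Channels. -/
abbrev Chan := String
/-- Program points. -/
abbrev PPoint := String
/-- Values. -/
abbrev Val := ℤ
/-- Stores map program variables to values. -/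
abbrev Store := PVar → Val

/-- Expressions: integer constants or variables. -/
inductive Expr where
  | const : Val → Expr
  | var : PVar → Expr
deriving DecidableEq

def Expr.eval : Expr → Store → Val
  | .const v, _ => v
  | .var x, σ => σ x

def Expr.fv : Expr → Set PVar
  | .const _ => ∅
  | .var x => {x}

/-- Commands of the while-language with annotated outputs. -/
inductive Cmd where
  | skip : Cmd
  | seq : Cmd → Cmd → Cmd
  | assign : PVar → Expr → Cmd
  | ite : Expr → Cmd → Cmd → Cmd
  | while : Expr → Cmd → Cmd
  | out : Expr → Chan → PPoint → Cmd
deriving DecidableEq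

/-- Step labels: silent, or an output (channel, value, program point). -/
inductive Label where
  | silent : Label
  | out : Chan → Val → PPoint → Label
deriving DecidableEq

abbrev Config := Cmd × Store

/-- Small-step semantics. -/
inductive Step : Config → Label → Config → Prop where
  | skipSeq : ∀ (c : Cmd) (σ : Store), Step (.seq .skip c, σ) .silent (c, σ)
  | seq : ∀ {c₁ : Cmd} {σ : Store} {α : Label} {c₁' : Cmd} {σ' : Store} (c₂ : Cmd),
      Step (c₁, σ) α (c₁', σ') → Step (.seq c₁ c₂, σ) α (.seq c₁' c₂, σ')
  | assign : ∀ (x : PVar) (e : Expr) (σ : Store),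
      Step (.assign x e, σ) .silent (.skip, Function.update σ x (e.eval σ))
  | out : ∀ (e : Expr) (a : Chan) (p : PPoint) (σ : Store),
      Step (.out e a p, σ) (.out a (e.eval σ) p) (.skip, σ)
  | whileStep : ∀ (e : Expr) (c : Cmd) (σ : Store),
      Step (.while e c, σ) .silent (.ite e (.seq c (.while e c)) .skip, σ)
  | iteTrue : ∀ {e : Expr} {σ : Store} (c₁ c₂ : Cmd),
      e.eval σ ≠ 0 → Step (.ite e c₁ c₂, σ) .silent (c₁, σ)
  | iteFalse : ∀ {e : Expr} {σ : Store} (c₁ c₂ : Cmd),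
      e.eval σ = 0 → Step (.ite e c₁ c₂, σ) .silent (c₂, σ)

/-- Prepend a label to a list of (output) labels, dropping silent labels. -/
def Label.consTo : Label → List Label → List Label
  | .silent, ls => ls
  | l, ls => l :: ls

/-- `Steps cfg ls n cfg'`: `n` evaluation steps from `cfg` to `cfg'`, producing
the list `ls` of output labels (silent steps contribute nothing). -/
inductive Steps : Config → List Label → ℕ → Config → Prop where
  | refl : ∀ cfg, Steps cfg [] 0 cfg
  | step : ∀ {cfg : Config} {α : Label} {cfg' : Config} {ls : List Label} {n : ℕ} {cfg'' : Config},
      Step cfg α cfg' → Steps cfg' ls n cfg'' → Steps cfg (α.consTo ls) (n+1) cfg''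

/-- Projection of a label list to the values output on channel `a`. -/
def projA (a : Chan) (ls : List Label) : List Val :=
  ls.filterMap fun l => match l with
    | .silent => none
    | .out b v _ => if b = a then some v else none

/-- `⟨c,σ⟩ ⇒t_a,n ⟨c',σ'⟩`: n steps producing trace `t` of values on channel `a`. -/
def ProjSteps (cfg : Config) (a : Chan) (t : List Val) (n : ℕ) (cfg' : Config) : Prop :=
  ∃ ls, Steps cfg ls n cfg' ∧ projA a ls = t

/-- `⟨c,σ⟩ ⇒t_a`: the run of `c` from `σ` produces trace `t` on channel `a`. -/
def Produces (c : Cmd) (σ : Store) (a : Chan) (t : List Val) : Prop :=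
  ∃ n cfg', ProjSteps (c, σ) a t n cfg'

/-- A forgetful attacker: a deterministic automaton over values. -/
structure Attacker (S : Type) where
  init : S
  step : S → Val → S

/-- The attacker's state after observing trace `t`. -/
def Attacker.run {S : Type} (A : Attacker S) (t : List Val) : S :=
  t.foldl A.step A.init

/-- The counting variant `A^ω` of an attacker. -/
def Attacker.omega {S : Type} (A : Attacker S) : Attacker (S × ℕ) where
  init := (A.init, 0)
  step := fun sn v => (A.step sn.1 v, sn.2 + 1)

/-- Attacker knowledge `k(A,c,a,t)`. -/
def know {S : Type} (A : Attacker S) (c : Cmd) (a : Chan) (t : List Val) : Set Store :=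
  { ρ | ∃ t', Produces c ρ a t' ∧ A.run t' = A.run t }

/-- Exclusion knowledge `ek(A,c,a,t)`. -/
def ek {S : Type} (A : Attacker S) (c : Cmd) (a : Chan) (t : List Val) : Set Store :=
  (know A c a t)ᶜ

/-- Full progress knowledge `k#(A,c,a,t)`. -/
def kSharp {S : Type} (A : Attacker S) (c : Cmd) (a : Chan) (t : List Val) : Set Store :=
  { ρ | ∃ t' v, Produces c ρ a (t' ++ [v]) ∧ A.omega.run t' = A.omega.run t }

/-- Exclusion version `ek#(A,c,a,t)`. -/
def ekSharp {S : Type} (A : Attacker S) (c : Cmd) (a : Chan) (t : List Val) : Set Store :=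
  (kSharp A c a t)ᶜ

/-- AC progress knowledge `k⁺(A,c,a,t)`. -/
def kPlus {S : Type} (A : Attacker S) (c : Cmd) (a : Chan) (t : List Val) : Set Store :=
  { ρ | ∃ t' v, Produces c ρ a (t' ++ [v]) ∧ A.run t' = A.run t }

/-- Exclusion version `ek⁺(A,c,a,t)`. -/
def ekPlus {S : Type} (A : Attacker S) (c : Cmd) (a : Chan) (t : List Val) : Set Store :=
  (kPlus A c a t)ᶜ

/-- A dynamic policy: an equivalence relation on stores per channel and execution point. -/
structure DynPolicy where
  rel : Chan → Cmd → Store → ℕ → Store → Store → Prop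
  isEquiv : ∀ a c σ n, Equivalence (rel a c σ n)

/-- Progress-insensitive security of `c` for policy `D` against attacker `A`
on channel `a` for initial store `σ`. -/
def PISecure {S : Type} (c : Cmd) (D : DynPolicy) (A : Attacker S) (a : Chan) (σ : Store) : Prop :=
  ∀ t n c' σ' v, ProjSteps (c, σ) a t n (c', σ') →
    (∃ cfg', ProjSteps (c', σ') a [v] 1 cfg') →
    ek A c a (t ++ [v]) \ ekSharp A c a t ⊆ { ρ | ¬ D.rel a c σ n ρ σ }

/-- AC progress-insensitive security of `c` for policy `D` against attacker `A`
on channel `a` for initial store `σ`. -/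
def ACPISecure {S : Type} (c : Cmd) (D : DynPolicy) (A : Attacker S) (a : Chan) (σ : Store) : Prop :=
  ∀ t n c' σ' v, ProjSteps (c, σ) a t n (c', σ') →
    (∃ cfg', ProjSteps (c', σ') a [v] 1 cfg') →
    ek A c a (t ++ [v]) \ ekPlus A c a t ⊆ { ρ | ¬ D.rel a c σ n ρ σ }

/-- Two-run progress-insensitive security. -/
def TwoRunPISecure (c : Cmd) (D : DynPolicy) (a : Chan) (σ : Store) : Prop :=
  ∀ t n cn σn v, ProjSteps (c, σ) a t n (cn, σn) →
    (∃ cfg', ProjSteps (cn, σn) a [v] 1 cfg') →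
    ∀ ρ t' v', D.rel a c σ n ρ σ → Produces c ρ a (t' ++ [v']) → t'.length = t.length →
      v' = v

/-- A counting attacker always remembers at least how many outputs it has seen. -/
def Attacker.Counting {S : Type} (A : Attacker S) : Prop :=
  ∀ t t' : List Val, A.run t = A.run t' → t.length = t'.length

/-- A command is quasi-constant if, per channel, all its traces are prefixes of
one fixed (possibly infinite) trace. -/
def QuasiConstant (c : Cmd) : Prop :=
  ∀ a : Chan, ∃ u : ℕ → Val, ∀ σ t, Produces c σ a t →
    ∀ i : Fin t.length, t.get i = u i.val

/-- The variables of the dependency type system. -/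
inductive TVar where
  | pvar : PVar → TVar
  | cpoint : Chan → PPoint → TVar
  | pc : TVar
  | chan : Chan → TVar
deriving DecidableEq

/-- Type environments. -/
abbrev Env := TVar → Set TVar

/-- The identity environment. -/
def idEnv : Env := fun x => {x}

/-- Sequential composition of environments: `(Γ₂;Γ₁)(x) = ⋃_{y ∈ Γ₂(x)} Γ₁(y)`. -/
def envComp (Γ₂ Γ₁ : Env) : Env := fun x => ⋃ y ∈ Γ₂ x, Γ₁ y

/-- Pointwise union of environments. -/
def envUnion (Γ₁ Γ₂ : Env) : Env := fun x => Γ₁ x ∪ Γ₂ x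

/-- Iterates of an environment. -/
def envIter (Γ : Env) : ℕ → Env
  | 0 => idEnv
  | n+1 => envComp (envIter Γ n) Γ

/-- The fixed point `Γ* = ⋃_{n≥0} Γⁿ`. -/
def envStar (Γ : Env) : Env := fun x => ⋃ n, envIter Γ n x

/-- Free variables of an expression, as type-system variables. -/
def fvT (e : Expr) : Set TVar := TVar.pvar '' e.fv

/-- The dependency type system `⊢{c}Γ`. -/
inductive Typing : Cmd → Env → Prop where
  | skip : Typing .skip idEnv
  | assign : ∀ (x : PVar) (e : Expr),
      Typing (.assign x e) (Function.update idEnv (.pvar x) (fvT e ∪ {TVar.pc}))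
  | seq : ∀ {c₁ : Cmd} {Γ₁ : Env} {c₂ : Cmd} {Γ₂ : Env},
      Typing c₁ Γ₁ → Typing c₂ Γ₂ → Typing (.seq c₁ c₂) (envComp Γ₂ Γ₁)
  | ite : ∀ {e : Expr} {c₁ : Cmd} {Γ₁ : Env} {c₂ : Cmd} {Γ₂ : Env},
      Typing c₁ Γ₁ → Typing c₂ Γ₂ →
      Typing (.ite e c₁ c₂)
        (Function.update
          (envUnion (envComp Γ₁ (Function.update idEnv .pc ({TVar.pc} ∪ fvT e)))
                    (envComp Γ₂ (Function.update idEnv .pc ({TVar.pc} ∪ fvT e))))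
          .pc {TVar.pc})
  | whileT : ∀ {e : Expr} {c : Cmd} {Γc : Env}, Typing c Γc →
      Typing (.while e c)
        (Function.update
          (envStar (envComp Γc (Function.update idEnv .pc ({TVar.pc} ∪ fvT e))))
          .pc {TVar.pc})
  | out : ∀ (e : Expr) (a : Chan) (p : PPoint),
      Typing (.out e a p)
        (Function.update
          (Function.update idEnv (.cpoint a p)
            (fvT e ∪ {TVar.pc, TVar.chan a, TVar.cpoint a p}))
          (.chan a) {TVar.pc, TVar.chan a})

/-- `σ ≡_{Γ(x)} ρ`: the stores agree on all program variables in `Γ(x)`. -/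
def eqG (Γ : Env) (x : TVar) (σ ρ : Store) : Prop :=
  ∀ y : PVar, TVar.pvar y ∈ Γ x → σ y = ρ y

/-- A dynamic policy approximation: an equivalence relation on stores per
channel–program-point pair. -/
structure PolApprox where
  rel : Chan → PPoint → Store → Store → Prop
  isEquiv : ∀ a p, Equivalence (rel a p)

/-- `c : A` is a sound approximation of dynamic policy `D`. -/
def SoundApprox (c : Cmd) (A : PolApprox) (D : DynPolicy) : Prop :=
  ∀ σ n ls c' σ' a v p cfg'',
    Steps (c, σ) ls n (c', σ') → Step (c', σ') (.out a v p) cfg'' →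
    ∀ ρ₁ ρ₂, D.rel a c σ n ρ₁ ρ₂ → A.rel a p ρ₁ ρ₂

/-- `c` may syntactically write to `x`. -/
def Touches : Cmd → TVar → Prop
  | .skip, _ => False
  | .seq c₁ c₂, x => Touches c₁ x ∨ Touches c₂ x
  | .assign y _, x => x = .pvar y
  | .ite _ c₁ c₂, x => Touches c₁ x ∨ Touches c₂ x
  | .while _ c, x => Touches c x
  | .out _ a p, x => x = .chan a ∨ x = .cpoint a p

theorem mem_comp_iff (Γ₂ Γ₁ : Env) (x z : TVar) :
    z ∈ envComp Γ₂ Γ₁ x ↔ ∃ y ∈ Γ₂ x, z ∈ Γ₁ y := by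
  simp [envComp]

theorem mem_guard (e : Expr) (x : TVar) :
    x ∈ (Function.update idEnv .pc ({TVar.pc} ∪ fvT e) : Env) x := by
  by_cases h : x = .pc
  · subst h; simp
  · simp [Function.update_of_ne h, idEnv]

theorem mem_comp_guard (Γ : Env) (e : Expr) {x z : TVar} (h : z ∈ Γ x) :
    z ∈ envComp Γ (Function.update idEnv .pc ({TVar.pc} ∪ fvT e)) x :=
  (mem_comp_iff _ _ _ _).2 ⟨z, h, mem_guard e z⟩

theorem typing_touches {c : Cmd} {Γ : Env} (h : Typing c Γ) :
    TVar.pc ∈ Γ .pc ∧ (∀ x, x ∈ Γ x ∨ TVar.pc ∈ Γ x) ∧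
      (∀ x, Touches c x → TVar.pc ∈ Γ x) := by
  induction h with
  | skip => simp [idEnv, Touches]
  | assign y e =>
    refine ⟨by simp [idEnv], fun x => ?_, fun x hx => ?_⟩
    · by_cases h : x = .pvar y
      · subst h; simp
      · simp [Function.update_of_ne h, idEnv]
    · cases hx; simp
  | seq h₁ h₂ ih₁ ih₂ =>
    obtain ⟨p₁, r₁, t₁⟩ := ih₁
    obtain ⟨p₂, r₂, t₂⟩ := ih₂
    simp only [mem_comp_iff]
    refine ⟨⟨_, p₂, p₁⟩, fun x => ?_, fun x hx => ?_⟩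
    · rcases r₂ x with h | h
      · rcases r₁ x with h' | h'
        · exact .inl ⟨_, h, h'⟩
        · exact .inr ⟨_, h, h'⟩
      · exact .inr ⟨_, h, p₁⟩
    · rcases hx with hx | hx
      · rcases r₂ x with h | h
        · exact ⟨_, h, t₁ x hx⟩
        · exact ⟨_, h, p₁⟩
      · exact ⟨_, t₂ x hx, p₁⟩
  | @ite e c₁ Γ₁ c₂ Γ₂ h₁ h₂ ih₁ ih₂ =>
    obtain ⟨p₁, r₁, t₁⟩ := ih₁
    obtain ⟨p₂, r₂, t₂⟩ := ih₂
    refine ⟨by simp, fun x => ?_, fun x hx => ?_⟩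
    · by_cases h : x = .pc
      · subst h; simp
      · rw [Function.update_of_ne h]
        exact (r₁ x).imp (fun h => .inl (mem_comp_guard _ _ h))
          (fun h => .inl (mem_comp_guard _ _ h))
    · by_cases h : x = .pc
      · subst h; simp
      · rw [Function.update_of_ne h]
        exact hx.imp (fun h => mem_comp_guard _ _ (t₁ x h)) (fun h => mem_comp_guard _ _ (t₂ x h))
  | @whileT e c Γc h ih =>
    obtain ⟨p, r, t⟩ := ih
    refine ⟨by simp, fun x => ?_, fun x hx => ?_⟩
    · by_cases h : x = .pc
      · subst h; simp
      · rw [Function.update_of_ne h]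
        exact .inl (Set.mem_iUnion.2 ⟨0, rfl⟩)
    · by_cases h : x = .pc
      · subst h; simp
      · rw [Function.update_of_ne h]
        refine Set.mem_iUnion.2 ⟨1, (mem_comp_iff _ _ _ _).2 ⟨x, rfl, ?_⟩⟩
        exact mem_comp_guard _ _ (t x hx)
  | out e a p =>
    refine ⟨by simp [idEnv], fun x => ?_, fun x hx => ?_⟩
    · by_cases h : x = .chan a
      · subst h; simp
      · rw [Function.update_of_ne h]
        by_cases h : x = .cpoint a p
        · subst h; simp
        · simp [Function.update_of_ne h, idEnv]
    · rcases hx with rfl | rfl <;> simp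

theorem step_touches {cfg cfg' : Config} {α : Label} (h : Step cfg α cfg') :
    (∀ x, Touches cfg'.1 x → Touches cfg.1 x) ∧
    (∀ y, ¬ Touches cfg.1 (.pvar y) → cfg.2 y = cfg'.2 y) ∧
    (∀ a v p, α = .out a v p → Touches cfg.1 (.chan a) ∧ Touches cfg.1 (.cpoint a p)) := by
  induction h with
  | seq c₂ h ih =>
    obtain ⟨i, j, k⟩ := ih
    refine ⟨fun x hx => hx.imp_left (i x), fun y hy => j y fun h => hy (.inl h),
      fun a v p h => ⟨.inl (k a v p h).1, .inl (k a v p h).2⟩⟩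
  | assign y e σ =>
    refine ⟨by simp [Touches], fun z hz => ?_, by simp⟩
    have : z ≠ y := fun h => hz (by simp [Touches, h])
    simp [Function.update_of_ne this]
  | out e a p σ => simp +contextual [Touches]
  | _ => simp +contextual [Touches]

theorem steps_touches {cfg cfg' : Config} {ls : List Label} {n : ℕ} (h : Steps cfg ls n cfg') :
    (∀ y, ¬ Touches cfg.1 (.pvar y) → cfg.2 y = cfg'.2 y) ∧
    (∀ a v p, Label.out a v p ∈ ls → Touches cfg.1 (.chan a) ∧ Touches cfg.1 (.cpoint a p)) := by
  induction h with
  | refl => simp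
  | @step _ α _ ls _ _ hs _ ih =>
    obtain ⟨i, j, k⟩ := step_touches hs
    refine ⟨fun y hy => (j y hy).trans (ih.1 y fun h => hy (i _ h)), fun a v p hm => ?_⟩
    have : α = .out a v p ∨ Label.out a v p ∈ ls := by
      cases α with
      | silent => exact .inr hm
      | out b w q => exact (List.mem_cons.1 hm).imp_left Eq.symm
    rcases this with h | h
    · exact k a v p h
    · exact (ih.2 a v p h).imp (i _) (i _)

/-- program counter lemma. -/
theorem pc_lemma {c : Cmd} {Γ : Env} (hty : Typing c Γ) :
    (∀ (x : PVar) (σ σ' : Store) (ls : List Label) (n : ℕ),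
       TVar.pc ∉ Γ (.pvar x) → Steps (c, σ) ls n (.skip, σ') → σ x = σ' x) ∧
    (∀ (a : Chan) (σ : Store) (ls : List Label) (n : ℕ) (cfg' : Config),
       TVar.pc ∉ Γ (.chan a) → Steps (c, σ) ls n cfg' → projA a ls = []) ∧
    (∀ (a : Chan) (p : PPoint) (σ : Store) (ls : List Label) (n : ℕ) (cfg' : Config),
       TVar.pc ∉ Γ (.cpoint a p) → Steps (c, σ) ls n cfg' →
       ∀ v : Val, Label.out a v p ∉ ls) := by
  obtain ⟨-, -, t⟩ := typing_touches hty
  refine ⟨fun x σ σ' ls n hx h => (steps_touches h).1 x fun h => hx (t _ h),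
    fun a σ ls n cfg' ha h => ?_,
    fun a p σ ls n cfg' ha h v hv => ha (t _ ((steps_touches h).2 a v p hv).2)⟩
  rw [projA, List.filterMap_eq_nil_iff]
  intro l hl
  cases l with
  | silent => rfl
  | out b v p =>
    have : b ≠ a := by
      rintro rfl
      exact ha (t _ ((steps_touches h).2 b v p hl).1)
    simp [this]
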